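/- Let R be a staircase with at least two blocks and m steps, and let r = [x1,x2]×[y1,y2] ∈ R be a deletable rectangle of type (1,0) whose top edge lies on the j-th step of R. Then R ∖ {r} is a staircase with exactly m steps. -/

import Mathlib

open Set

/-- A block is a closed axis-parallel rectangle `[x1,x2] × [y1,y2]` with `x1 < x2`, `y1 < y2`. -/
def IsBlock (b : Set (ℝ × ℝ)) : Prop :=
  ∃ x1 x2 y1 y2 : ℝ, x1 < x2 ∧ y1 < y2 ∧ b = Icc x1 x2 ×ˢ Icc y1 y2

/-- `R` is a staircase with `m` steps, step x-coordinates `a 0 < a 1 < ⋯ < a m`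
(with `a 0 = 0`) and step heights `h 1 > h 2 > ⋯ > h m > 0`. -/
def IsStaircaseWith (R : Finset (Set (ℝ × ℝ))) (m : ℕ) (a h : ℕ → ℝ) : Prop :=
  R.Nonempty ∧
  (∀ b ∈ R, IsBlock b) ∧
  (∀ b ∈ R, ∀ b' ∈ R, b ≠ b' → interior b ∩ interior b' = ∅) ∧
  (∀ (p : ℝ × ℝ) (b1 b2 b3 b4 : Set (ℝ × ℝ)),
      b1 ∈ R → b2 ∈ R → b3 ∈ R → b4 ∈ R →
      p ∈ b1 → p ∈ b2 → p ∈ b3 → p ∈ b4 →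
      b1 = b2 ∨ b1 = b3 ∨ b1 = b4 ∨ b2 = b3 ∨ b2 = b4 ∨ b3 = b4) ∧
  1 ≤ m ∧
  a 0 = 0 ∧
  (∀ j, j < m → a j < a (j + 1)) ∧
  (∀ j, 1 ≤ j → j < m → h (j + 1) < h j) ∧
  0 < h m ∧
  ⋃₀ (R : Set (Set (ℝ × ℝ))) =
    ⋃ j ∈ Finset.Icc 1 m, Icc (a (j - 1)) (a j) ×ˢ Icc (0 : ℝ) (h j)

/-- `R` is a staircase. -/
def IsStaircase (R : Finset (Set (ℝ × ℝ))) : Prop :=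
  ∃ m a h, IsStaircaseWith R m a h

/-- `r` is a deletable rectangle of `R`: a block of `R` whose top edge and right
edge are both contained in the topological boundary of `⋃ R`. -/
def IsDeletable (R : Finset (Set (ℝ × ℝ))) (r : Set (ℝ × ℝ)) : Prop :=
  r ∈ R ∧ ∃ x1 x2 y1 y2 : ℝ, x1 < x2 ∧ y1 < y2 ∧ r = Icc x1 x2 ×ˢ Icc y1 y2 ∧
    (Icc x1 x2 ×ˢ ({y2} : Set ℝ)) ⊆ frontier (⋃₀ (R : Set (Set (ℝ × ℝ)))) ∧
    (({x2} : Set ℝ) ×ˢ Icc y1 y2) ⊆ frontier (⋃₀ (R : Set (Set (ℝ × ℝ))))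

/-- A mosaic floorplan is a staircase with exactly one step. -/
def IsMosaicFloorplan (M : Finset (Set (ℝ × ℝ))) : Prop :=
  ∃ a h, IsStaircaseWith M 1 a h

noncomputable instance : DecidableEq (Set (ℝ × ℝ)) := Classical.decEq _

/-- The region under the staircase-shaped path with corners `a` and heights `h`. -/
def stepRegion (m : ℕ) (a h : ℕ → ℝ) : Set (ℝ × ℝ) :=
  ⋃ i ∈ Finset.Icc 1 m, Icc (a (i - 1)) (a i) ×ˢ Icc (0 : ℝ) (h i)

theorem mem_stepRegion {m : ℕ} {a h : ℕ → ℝ} {p : ℝ × ℝ} :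
    p ∈ stepRegion m a h ↔
      ∃ i, (1 ≤ i ∧ i ≤ m) ∧ p ∈ Icc (a (i - 1)) (a i) ×ˢ Icc (0 : ℝ) (h i) := by
  simp only [stepRegion, mem_iUnion, Finset.mem_Icc, exists_prop]

theorem isClosed_stepRegion (m : ℕ) (a h : ℕ → ℝ) : IsClosed (stepRegion m a h) :=
  (Finset.Icc 1 m).finite_toSet.isClosed_biUnion fun _ _ => isClosed_Icc.prod isClosed_Icc

theorem IsBlock.isClosed {b : Set (ℝ × ℝ)} (hb : IsBlock b) : IsClosed b := by
  obtain ⟨x1, x2, y1, y2, -, -, rfl⟩ := hb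
  exact isClosed_Icc.prod isClosed_Icc

theorem IsBlock.closure_interior {b : Set (ℝ × ℝ)} (hb : IsBlock b) :
    closure (interior b) = b := by
  obtain ⟨x1, x2, y1, y2, hx, hy, rfl⟩ := hb
  rw [interior_prod_eq, interior_Icc, interior_Icc, closure_prod_eq, closure_Ioo hx.ne,
    closure_Ioo hy.ne]

theorem IsBlock.disjoint_interior {b c : Set (ℝ × ℝ)} (hc : IsBlock c)
    (h : interior b ∩ interior c = ∅) : Disjoint (interior b) c := by
  have := (disjoint_iff_inter_eq_empty.mpr h).closure_right isOpen_interior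
  rwa [hc.closure_interior] at this

/-- Erasing a block from a family of blocks with disjoint interiors leaves the closure of the
set-theoretic difference. -/
theorem sUnion_erase_eq_closure {R : Finset (Set (ℝ × ℝ))} {r : Set (ℝ × ℝ)}
    (hblock : ∀ b ∈ R, IsBlock b)
    (hdisj : ∀ b ∈ R, ∀ b' ∈ R, b ≠ b' → interior b ∩ interior b' = ∅) (hr : r ∈ R) :
    ⋃₀ ((R.erase r : Finset (Set (ℝ × ℝ))) : Set (Set (ℝ × ℝ))) =
      closure (⋃₀ (R : Set (Set (ℝ × ℝ))) \ r) := by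
  apply Subset.antisymm
  · refine sUnion_subset fun b hb => ?_
    obtain ⟨hne, hbR⟩ := Finset.mem_erase.mp (Finset.mem_coe.mp hb)
    rw [← (hblock b hbR).closure_interior]
    refine closure_mono fun p hp => ⟨⟨b, hbR, interior_subset hp⟩, ?_⟩
    exact disjoint_left.mp
      ((hblock r hr).disjoint_interior (hdisj b hbR r hr hne)) hp
  · refine closure_minimal ?_ ?_
    · rintro p ⟨⟨b, hb, hp⟩, hpr⟩
      refine ⟨b, Finset.mem_coe.mpr (Finset.mem_erase.mpr ⟨?_, hb⟩), hp⟩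
      rintro rfl
      exact hpr hp
    · rw [sUnion_eq_biUnion]
      exact (R.erase r).finite_toSet.isClosed_biUnion fun b hb =>
        (hblock b (Finset.mem_of_mem_erase hb)).isClosed

theorem le_of_forall_lt_succ {a : ℕ → ℝ} {m : ℕ} (ha : ∀ j, j < m → a j < a (j + 1))
    {k l : ℕ} (hkl : k ≤ l) (hl : l ≤ m) : a k ≤ a l := by
  induction l, hkl using Nat.le_induction with
  | base => rfl
  | succ n _ ih => exact (ih (by omega)).trans (ha n (by omega)).le

theorem height_pos {h : ℕ → ℝ} {m : ℕ} (hh : ∀ j, 1 ≤ j → j < m → h (j + 1) < h j)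
    (hm : 0 < h m) {i : ℕ} (hi : 1 ≤ i) (him : i ≤ m) : 0 < h i := by
  induction him using Nat.decreasingInduction with
  | self => exact hm
  | of_succ n hn ih => exact (ih (by omega)).trans (hh n hi hn)

/-- Removing the top part of a single column lowers the corresponding step. -/
theorem closure_stepRegion_diff {m : ℕ} {a h : ℕ → ℝ} (ha : ∀ i, i < m → a i < a (i + 1))
    (hpos : ∀ i, 1 ≤ i → i ≤ m → 0 < h i) {j : ℕ} (hj1 : 1 ≤ j) (hjm : j ≤ m) {y : ℝ}
    (hy0 : 0 < y) (hy : y < h j) :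
    closure (stepRegion m a h \ Icc (a (j - 1)) (a j) ×ˢ Icc y (h j)) =
      stepRegion m a (Function.update h j y) := by
  apply Subset.antisymm
  · refine closure_minimal ?_ (isClosed_stepRegion _ _ _)
    rintro p ⟨hp, hpr⟩
    obtain ⟨i, hi, hpx, hpy⟩ := mem_stepRegion.mp hp
    refine mem_stepRegion.mpr ⟨i, hi, hpx, ?_⟩
    obtain rfl | hij := eq_or_ne i j
    · rw [Function.update_self]
      refine ⟨hpy.1, ?_⟩
      by_contra! hlt
      exact hpr ⟨hpx, hlt.le, hpy.2⟩
    · rwa [Function.update_of_ne hij]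
  · intro p hp
    obtain ⟨i, ⟨hi1, him⟩, hp⟩ := mem_stepRegion.mp hp
    have hai : a (i - 1) < a i := by
      have := ha (i - 1) (by omega)
      rwa [Nat.sub_add_cancel hi1] at this
    have hle : Function.update h j y i ≤ h i := by
      obtain rfl | hij := eq_or_ne i j
      · simpa using hy.le
      · simp [hij]
    have hpos' : 0 < Function.update h j y i := by
      obtain rfl | hij := eq_or_ne i j
      · simpa using hy0
      · simpa [hij] using hpos i hi1 him
    rw [← closure_Ioo hai.ne, ← closure_Ioo hpos'.ne, ← closure_prod_eq] at hp
    refine closure_mono ?_ hp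
    rintro q ⟨⟨hq1, hq2⟩, hq3, hq4⟩
    refine ⟨mem_stepRegion.mpr ⟨i, ⟨hi1, him⟩, ⟨hq1.le, hq2.le⟩, hq3.le, hq4.le.trans hle⟩, ?_⟩
    rintro ⟨⟨hr1, hr2⟩, hr3, -⟩
    obtain hij | rfl | hij := lt_trichotomy i j
    · exact absurd (le_of_forall_lt_succ ha (show i ≤ j - 1 by omega) (by omega))
        (hr1.trans_lt hq2).not_ge
    · rw [Function.update_self] at hq4
      exact hr3.not_gt hq4
    · exact absurd (le_of_forall_lt_succ ha (show j ≤ i - 1 by omega) (by omega))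
        (hq1.trans_le hr2).not_ge

/-- Let `R` be a staircase with at least two blocks and `m`
steps, and let `r = [x1,x2] × [y1,y2] ∈ R` be a deletable rectangle of type
`(1,0)` whose top edge lies on the `j`-th step of `R` (so `y2 = h j` and
`x2 = a j`; here `h'` is `h (j+1)` if `j < m` and `0` if `j = m`).
Then `R \ {r}` is a staircase with exactly `m` steps. -/
theorem erase_type10_steps (R : Finset (Set (ℝ × ℝ))) (m : ℕ) (a h : ℕ → ℝ)
    (hR : IsStaircaseWith R m a h) (hcard : 2 ≤ R.card)
    (x1 x2 y1 y2 : ℝ) (hx : x1 < x2) (hy : y1 < y2)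
    (hr : IsDeletable R (Icc x1 x2 ×ˢ Icc y1 y2))
    (j : ℕ) (hj1 : 1 ≤ j) (hjm : j ≤ m)
    (htop : y2 = h j) (hright : x2 = a j)
    (htype1 : x1 = a (j - 1))
    (htype2 : (if j < m then h (j + 1) else 0) < y1) :
    ∃ a' h', IsStaircaseWith (R.erase (Icc x1 x2 ×ˢ Icc y1 y2)) (m) a' h' := by
  obtain ⟨-, hblock, hdisj, hfour, hm, ha0, ha, hh, hhm, hU⟩ := hR
  subst htop hright htype1
  have hpos : ∀ i, 1 ≤ i → i ≤ m → 0 < h i := fun i => height_pos hh hhm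
  have hy0 : 0 < y1 := by
    split_ifs at htype2 with hlt
    · exact (hpos (j + 1) (by omega) hlt).trans htype2
    · exact htype2
  refine ⟨a, Function.update h j y1, ?_, fun b hb => hblock b (Finset.mem_of_mem_erase hb),
    fun b hb b' hb' => hdisj b (Finset.mem_of_mem_erase hb) b' (Finset.mem_of_mem_erase hb'),
    fun p b1 b2 b3 b4 h1 h2 h3 h4 => hfour p b1 b2 b3 b4 (Finset.mem_of_mem_erase h1)
      (Finset.mem_of_mem_erase h2) (Finset.mem_of_mem_erase h3) (Finset.mem_of_mem_erase h4),
    hm, ha0, ha, fun i hi1 him => ?_, ?_, ?_⟩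
  · rw [← Finset.card_pos, Finset.card_erase_of_mem hr.1]
    omega
  · obtain rfl | hij := eq_or_ne i j
    · simpa [him] using htype2
    · rw [Function.update_of_ne hij]
      obtain rfl | hij' := eq_or_ne (i + 1) j
      · simpa using hy.trans (hh i hi1 him)
      · simpa [hij'] using hh i hi1 him
  · obtain rfl | hmj := eq_or_ne m j
    · simpa using hy0
    · simpa [hmj] using hhm
  · rw [sUnion_erase_eq_closure hblock hdisj hr.1, hU]
    exact closure_stepRegion_diff ha hpos hj1 hjm hy0 hy
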